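/- Let λ = (k, 1^{ℓ−1}) be a hook partition where k = 2 or ℓ = 2 (and k, ℓ ≥ 2 where relevant, covering the cases λ = (2,1), λ = (2,1^{ℓ−1}) with ℓ ≥ 3, and λ = (k,1) with k ≥ 3). Then for any number of variables n ≥ ℓ(λ), the symmetric polynomial (s_λ^{(1)})^2 − s_λ · s_λ^{(2)} in the variables x_1,…,x_n is Schur positive. -/

import Mathlib

open MvPolynomial

noncomputable section

/-- The complete homogeneous symmetric polynomial in `n` variables, indexed by an
integer (by convention it is `0` for negative indices). -/
def hInt (n : ℕ) (k : ℤ) : MvPolynomial (Fin n) ℚ :=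
  if 0 ≤ k then MvPolynomial.hsymm (Fin n) ℚ k.toNat else 0

/-- The number of (nonzero) parts of a partition `lam : ℕ → ℕ` (parts are indexed
starting from `0`). -/
def partLen (lam : ℕ → ℕ) : ℕ := sInf {N | lam N = 0}

/-- A partition, recorded as a weakly decreasing, eventually zero function `ℕ → ℕ`
listing its parts (indexed starting from `0`). -/
def IsPartition (lam : ℕ → ℕ) : Prop := Antitone lam ∧ ∃ N, ∀ i, N ≤ i → lam i = 0

/-- The Schur polynomial of a partition in `n` variables, via the Jacobi-Trudi identity
`s_lam = det (h_{lam_i + j - i})`. -/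
def schur (n : ℕ) (lam : ℕ → ℕ) : MvPolynomial (Fin n) ℚ :=
  (Matrix.of fun i j : Fin (partLen lam) =>
    hInt n ((lam i : ℤ) + ((j : ℕ) : ℤ) - ((i : ℕ) : ℤ))).det

/-- The `i`-th derived polynomial `p^{(i)}` of `p`, defined by the identity
`p (x₁ + t, …, xₙ + t) = ∑ i, t^i • p^{(i)} (x₁, …, xₙ)`: substituting `X j + t` for each
variable `X j` yields a polynomial in `t` whose `t^i`-coefficient is `p^{(i)}`. -/
def derived (n i : ℕ) (p : MvPolynomial (Fin n) ℚ) : MvPolynomial (Fin n) ℚ :=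
  (MvPolynomial.aeval
    (fun j : Fin n => (Polynomial.C (X j) + Polynomial.X : Polynomial (MvPolynomial (Fin n) ℚ)))
    p).coeff i

/-- A symmetric polynomial is Schur positive if it is a linear combination of Schur
polynomials (of partitions) with non-negative coefficients. -/
def SchurPositive (n : ℕ) (f : MvPolynomial (Fin n) ℚ) : Prop :=
  ∃ (S : Finset (ℕ → ℕ)) (c : (ℕ → ℕ) → ℚ),
    (∀ μ ∈ S, IsPartition μ) ∧ (∀ μ ∈ S, 0 ≤ c μ) ∧ f = ∑ μ ∈ S, c μ • schur n μ



/-- The generating power series of the complete homogeneous symmetric polynomials. -/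
def hGen (n : ℕ) : PowerSeries (MvPolynomial (Fin n) ℚ) :=
  ∏ i : Fin n, PowerSeries.mk fun k => X i ^ k

lemma coeff_hGen (n m : ℕ) : PowerSeries.coeff m (hGen n) = hsymm (Fin n) ℚ m := by
  classical
  rw [hGen, PowerSeries.coeff_prod, hsymm]
  symm
  refine Finset.sum_bij' (fun s _ => Multiset.toFinsupp s.1)
    (fun l hl => ⟨Finsupp.toMultiset l, ?_⟩) ?_ ?_ ?_ ?_ ?_
  · rw [Finset.mem_finsuppAntidiag] at hl
    rw [Finsupp.card_toMultiset, Finsupp.sum_fintype _ _ (fun _ => rfl)]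
    exact hl.1
  · intro s _
    rw [Finset.mem_finsuppAntidiag]
    refine ⟨?_, Finset.subset_univ _⟩
    have h := Finsupp.card_toMultiset (Multiset.toFinsupp s.1)
    rw [Finsupp.sum_fintype _ _ (fun _ => rfl), Multiset.toFinsupp_toMultiset] at h
    exact h.symm.trans s.2
  · intro l _
    exact Finset.mem_univ _
  · intro s _
    exact Subtype.ext (Multiset.toFinsupp_toMultiset s.1)
  · intro l _
    exact Finsupp.toMultiset_toFinsupp l
  · intro s _
    rw [Finset.prod_multiset_map_count]
    simp only [PowerSeries.coeff_mk, Multiset.toFinsupp_apply]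
    refine Finset.prod_subset (Finset.subset_univ _) fun i _ hi => ?_
    rw [Multiset.mem_toFinset] at hi
    rw [Multiset.count_eq_zero_of_notMem hi, pow_zero]

lemma mk_pow_mul_one_sub {R : Type*} [CommRing R] (x : R) :
    (PowerSeries.mk fun k => x ^ k) *
      ((1 - Polynomial.C x * Polynomial.X : Polynomial R) : PowerSeries R) = 1 := by
  ext m
  simp only [Polynomial.coe_sub, Polynomial.coe_one, Polynomial.coe_mul, Polynomial.coe_C,
    Polynomial.coe_X, mul_sub, mul_one, map_sub, PowerSeries.coeff_mk]
  rw [← mul_assoc, mul_comm _ (PowerSeries.C x)]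
  cases m with
  | zero => simp
  | succ m => simp [mul_assoc, PowerSeries.coeff_succ_mul_X, pow_succ']

/-- `∏_{i ∈ s} (1 - xᵢ t)` as a polynomial in `t`. -/
def eGen (n : ℕ) (s : Finset (Fin n)) : Polynomial (MvPolynomial (Fin n) ℚ) :=
  ∏ i ∈ s, (1 - Polynomial.C (X i) * Polynomial.X)

lemma natDegree_eGen_le (n : ℕ) (s : Finset (Fin n)) : (eGen n s).natDegree ≤ s.card := by
  refine (Polynomial.natDegree_prod_le _ _).trans ?_
  rw [Finset.card_eq_sum_ones]
  refine Finset.sum_le_sum fun i _ => ?_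
  compute_degree

lemma coeff_eGen_univ (n k : ℕ) :
    (eGen n Finset.univ).coeff k = (-1) ^ k * esymm (Fin n) ℚ k := by
  have h : eGen n Finset.univ = ∑ s ∈ (Finset.univ : Finset (Fin n)).powerset,
      Polynomial.C ((-1) ^ s.card * ∏ i ∈ s, X i) * Polynomial.X ^ s.card := by
    rw [eGen]
    simp only [sub_eq_add_neg, Finset.prod_one_add]
    refine Finset.sum_congr rfl fun s _ => ?_
    have h (i : Fin n) : -(Polynomial.C (X i : MvPolynomial (Fin n) ℚ) * Polynomial.X) =
        -1 * (Polynomial.C (X i) * Polynomial.X) := by ring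
    simp only [h]
    rw [Finset.prod_mul_distrib, Finset.prod_mul_distrib, Finset.prod_const, Finset.prod_const,
      map_mul, map_prod]
    simp [mul_assoc]
  rw [h, Polynomial.finsetSum_coeff, esymm, Finset.mul_sum,
    Finset.powersetCard_eq_filter, Finset.sum_filter]
  refine Finset.sum_congr rfl fun s _ => ?_
  rw [Polynomial.coeff_C_mul_X_pow]
  by_cases hs : s.card = k
  · simp [hs]
  · rw [if_neg (Ne.symm hs), if_neg hs]

lemma hGen_mul_eGen_compl (n : ℕ) (s : Finset (Fin n)) :
    hGen n * (eGen n s : PowerSeries (MvPolynomial (Fin n) ℚ)) =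
      ∏ i ∈ sᶜ, PowerSeries.mk fun k => (X i : MvPolynomial (Fin n) ℚ) ^ k := by
  classical
  have h : (eGen n s : PowerSeries (MvPolynomial (Fin n) ℚ)) =
      ∏ i ∈ s, ((1 - Polynomial.C (X i) * Polynomial.X : Polynomial (MvPolynomial (Fin n) ℚ)) :
        PowerSeries (MvPolynomial (Fin n) ℚ)) := by
    rw [eGen]
    exact map_prod Polynomial.coeToPowerSeries.ringHom _ _
  rw [hGen, ← Finset.prod_mul_prod_compl s, h, mul_right_comm, ← Finset.prod_mul_distrib]
  simp only [mk_pow_mul_one_sub, Finset.prod_const_one, one_mul]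

lemma hInt_natCast (n m : ℕ) : hInt n m = hsymm (Fin n) ℚ m := by
  simp [hInt]

lemma hInt_of_neg (n : ℕ) {z : ℤ} (hz : z < 0) : hInt n z = 0 :=
  if_neg (not_le.mpr hz)

lemma hInt_zero (n : ℕ) : hInt n 0 = 1 := by
  simp [hInt]

lemma sum_hInt_mul_coeff (n N a : ℕ) (q : Polynomial (MvPolynomial (Fin n) ℚ))
    (hq : q.natDegree < N) :
    ∑ k ∈ Finset.range N, hInt n ((a : ℤ) - k) * q.coeff k =
      PowerSeries.coeff a (hGen n * (q : PowerSeries (MvPolynomial (Fin n) ℚ))) := by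
  have h1 : ∑ k ∈ Finset.range N, hInt n ((a : ℤ) - k) * q.coeff k =
      ∑ k ∈ Finset.range (a + 1 + N), hInt n ((a : ℤ) - k) * q.coeff k := by
    refine Finset.sum_subset (fun k => by simp only [Finset.mem_range]; omega) fun k _ hk => ?_
    rw [Finset.mem_range, not_lt] at hk
    rw [Polynomial.coeff_eq_zero_of_natDegree_lt (hq.trans_le hk), mul_zero]
  have h2 : ∑ k ∈ Finset.range (a + 1), hInt n ((a : ℤ) - k) * q.coeff k =
      ∑ k ∈ Finset.range (a + 1 + N), hInt n ((a : ℤ) - k) * q.coeff k := by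
    refine Finset.sum_subset (fun k => by simp only [Finset.mem_range]; omega) fun k _ hk => ?_
    rw [Finset.mem_range, not_lt] at hk
    rw [hInt_of_neg n (by omega), zero_mul]
  rw [h1, ← h2, mul_comm, PowerSeries.coeff_mul,
    Finset.Nat.sum_antidiagonal_eq_sum_range_succ_mk]
  refine Finset.sum_congr rfl fun k hk => ?_
  rw [Finset.mem_range] at hk
  rw [Polynomial.coeff_coe, coeff_hGen, ← hInt_natCast, mul_comm, Nat.cast_sub (by omega)]

/-- The Jacobi–Trudi determinant of size `N` of a sequence of row indices. -/
def jacobiTrudi (n N : ℕ) (β : ℕ → ℕ) : MvPolynomial (Fin n) ℚ :=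
  (Matrix.of fun i j : Fin N => hInt n ((β i : ℤ) + ((j : ℕ) : ℤ) - ((i : ℕ) : ℤ))).det

lemma sum_jacobiTrudi_row (n N : ℕ) (β : ℕ → ℕ) (i : Fin N)
    (q : Polynomial (MvPolynomial (Fin n) ℚ)) (hq : q.natDegree < N) :
    ∑ j : Fin N, hInt n ((β i : ℤ) + ((j : ℕ) : ℤ) - ((i : ℕ) : ℤ)) * q.coeff (N - 1 - j) =
      PowerSeries.coeff (β i + (N - 1 - i))
        (hGen n * (q : PowerSeries (MvPolynomial (Fin n) ℚ))) := by
  rw [← sum_hInt_mul_coeff n N _ q hq, ← Finset.sum_range_reflect, Finset.sum_range]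
  refine Finset.sum_congr rfl fun j _ => ?_
  have := i.2
  have := j.2
  congr 2
  push_cast [Nat.cast_sub (show (i : ℕ) ≤ N - 1 by omega),
    Nat.cast_sub (show (j : ℕ) ≤ N - 1 by omega), Nat.cast_sub (show 1 ≤ N by omega)]
  ring

/-- The alternant `det (xⱼ ^ (βᵢ + n - 1 - i))`. -/
def alternant (n : ℕ) (β : ℕ → ℕ) : MvPolynomial (Fin n) ℚ :=
  (Matrix.of fun i j : Fin n => (X j : MvPolynomial (Fin n) ℚ) ^ (β i + (n - 1 - i))).det

lemma alternant_eq_mul (n : ℕ) (β : ℕ → ℕ) :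
    alternant n β = jacobiTrudi n n β *
      (Matrix.of fun k j : Fin n => (eGen n {j}ᶜ).coeff (n - 1 - k)).det := by
  rw [alternant, jacobiTrudi, ← Matrix.det_mul]
  congr 1
  ext1 i j
  have hd : (eGen n {j}ᶜ).natDegree < n := by
    refine (natDegree_eGen_le n _).trans_lt ?_
    rw [Finset.card_compl, Fintype.card_fin, Finset.card_singleton]
    exact Nat.sub_lt (Nat.zero_lt_of_lt i.2) one_pos
  rw [Matrix.mul_apply]
  simp only [Matrix.of_apply]
  rw [sum_jacobiTrudi_row n n β i _ hd, hGen_mul_eGen_compl, compl_compl, Finset.prod_singleton,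
    PowerSeries.coeff_mk]

lemma jacobiTrudi_zero (n N : ℕ) : jacobiTrudi n N 0 = 1 := by
  rw [jacobiTrudi, Matrix.det_of_isUpperTriangular]
  · simp [hInt_zero]
  · intro i j hij
    have hij : j < i := hij
    have : (j : ℕ) < i := hij
    simp only [Matrix.of_apply, Pi.zero_apply]
    exact hInt_of_neg n (by push_cast; omega)

/-- The bialternant formula. -/
lemma jacobiTrudi_mul_alternant (n : ℕ) (β : ℕ → ℕ) :
    jacobiTrudi n n β * alternant n 0 = alternant n β := by
  rw [alternant_eq_mul n 0, jacobiTrudi_zero, one_mul, ← alternant_eq_mul]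

lemma alternant_zero_ne_zero (n : ℕ) : alternant n 0 ≠ 0 := by
  have h : alternant n 0 = ((Matrix.vandermonde fun i : Fin n =>
      (X i : MvPolynomial (Fin n) ℚ)).transpose.submatrix Fin.revPerm id).det := by
    rw [alternant]
    congr 1
    ext1 i j
    simp only [Matrix.of_apply, Pi.zero_apply, zero_add, Matrix.submatrix_apply,
      Matrix.transpose_apply, Matrix.vandermonde_apply, Fin.revPerm_apply, Fin.val_rev, id]
    congr 1
    omega
  rw [h, Matrix.det_permute, Matrix.det_transpose]
  refine mul_ne_zero ?_ (Matrix.det_vandermonde_ne_zero_iff.mpr X_injective)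
  rcases Int.units_eq_one_or (Equiv.Perm.sign (Fin.revPerm : Equiv.Perm (Fin n))) with h | h <;>
    simp [h]

/-- The indicator function of a finite set of natural numbers. -/
def ind (T : Finset ℕ) (i : ℕ) : ℕ := if i ∈ T then 1 else 0

lemma esymm_mul_alternant (n m : ℕ) (β : ℕ → ℕ) :
    esymm (Fin n) ℚ m * alternant n β =
      ∑ T ∈ Finset.powersetCard m (Finset.range n), alternant n (β + ind T) := by
  have hsum : ∑ T ∈ Finset.powersetCard m (Finset.range n), alternant n (β + ind T) =
      ∑ S ∈ Finset.powersetCard m (Finset.univ : Finset (Fin n)),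
        alternant n (β + ind (S.map Fin.valEmbedding)) := by
    have : Finset.range n = (Finset.univ : Finset (Fin n)).map Fin.valEmbedding := by
      rw [Fin.map_valEmbedding_univ, Nat.Iio_eq_range]
    rw [this, Finset.powersetCard_map, Finset.sum_map]
    rfl
  have hperm (σ : Equiv.Perm (Fin n)) : esymm (Fin n) ℚ m =
      ∑ S ∈ Finset.powersetCard m (Finset.univ : Finset (Fin n)), ∏ i ∈ S, X (σ i) := by
    rw [← esymm_isSymmetric (Fin n) ℚ m σ, esymm, map_sum]
    simp only [map_prod, rename_X]
  rw [hsum]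
  simp only [alternant]
  simp_rw [← Matrix.det_transpose (Matrix.of fun i j : Fin n => _), Matrix.det_apply]
  rw [Finset.sum_comm, Finset.mul_sum]
  refine Finset.sum_congr rfl fun σ _ => ?_
  rw [mul_smul_comm, ← Finset.smul_sum, hperm σ, Finset.sum_mul]
  congr 1
  refine Finset.sum_congr rfl fun S _ => ?_
  simp only [Matrix.transpose_apply, Matrix.of_apply, Pi.add_apply]
  have hS : ∏ i ∈ S, (X (σ i) : MvPolynomial (Fin n) ℚ) =
      ∏ i, X (σ i) ^ ind (S.map Fin.valEmbedding) i := by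
    rw [← Finset.prod_subset (Finset.subset_univ S)]
    · exact Finset.prod_congr rfl fun i hi => by simp [ind, hi, Fin.val_inj]
    · exact fun i _ hi => by simp [ind, hi, Fin.val_inj]
  rw [hS, ← Finset.prod_mul_distrib]
  refine Finset.prod_congr rfl fun i _ => ?_
  rw [← pow_add]
  congr 1
  ring

/-- The vertical strip Pieri rule, for determinants with arbitrary row indices. -/
lemma esymm_mul_jacobiTrudi (n m : ℕ) (β : ℕ → ℕ) :
    esymm (Fin n) ℚ m * jacobiTrudi n n β =
      ∑ T ∈ Finset.powersetCard m (Finset.range n), jacobiTrudi n n (β + ind T) := by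
  apply mul_right_cancel₀ (alternant_zero_ne_zero n)
  rw [mul_assoc, jacobiTrudi_mul_alternant, esymm_mul_alternant, Finset.sum_mul]
  simp only [jacobiTrudi_mul_alternant]

lemma jacobiTrudi_eq_zero (n N : ℕ) (β : ℕ → ℕ) {i : ℕ} (hi : i + 1 < N)
    (h : β (i + 1) = β i + 1) : jacobiTrudi n N β = 0 := by
  refine Matrix.det_zero_of_row_eq (i := ⟨i, by omega⟩) (j := ⟨i + 1, hi⟩) (by simp) ?_
  ext1 j
  simp only [Matrix.of_apply, h]
  congr 1
  push_cast
  ring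

lemma jacobiTrudi_succ (n N : ℕ) (β : ℕ → ℕ) (h : β N = 0) :
    jacobiTrudi n (N + 1) β = jacobiTrudi n N β := by
  rw [jacobiTrudi, Matrix.det_succ_row _ (Fin.last N), Finset.sum_eq_single (Fin.last N)]
  · simp only [Matrix.of_apply, Fin.val_last, h, Nat.cast_zero, zero_add, sub_self, hInt_zero,
      mul_one, Fin.succAbove_last, ← two_mul, pow_mul, neg_one_sq, one_pow, one_mul]
    rfl
  · intro j _ hj
    have : (j : ℕ) < N := Fin.val_lt_last hj
    rw [Matrix.of_apply, hInt_of_neg n, mul_zero, zero_mul]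
    rw [Fin.val_last, h]
    omega
  · simp

lemma jacobiTrudi_of_le (n : ℕ) {M N : ℕ} (β : ℕ → ℕ) (hMN : M ≤ N)
    (h : ∀ i, M ≤ i → β i = 0) : jacobiTrudi n N β = jacobiTrudi n M β := by
  induction N, hMN using Nat.le_induction with
  | base => rfl
  | succ N hN ih => rw [jacobiTrudi_succ n N β (h N hN), ih]

lemma jacobiTrudi_congr (n N : ℕ) {β γ : ℕ → ℕ} (h : ∀ i < N, β i = γ i) :
    jacobiTrudi n N β = jacobiTrudi n N γ := by
  unfold jacobiTrudi
  congr 2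
  ext1 i
  ext1 j
  rw [h i i.2]

lemma jacobiTrudi_eq_zero_of_lt (n N : ℕ) (β : ℕ → ℕ) (hN : n < N) (h : ∀ i < N, 0 < β i) :
    jacobiTrudi n N β = 0 := by
  have hd : (eGen n Finset.univ).natDegree < N :=
    (natDegree_eGen_le n _).trans_lt (by simpa using hN)
  refine Matrix.exists_mulVec_eq_zero_iff.mp
    ⟨fun j => (eGen n Finset.univ).coeff (N - 1 - j), fun h0 => ?_, ?_⟩
  · have := congrFun h0 ⟨N - 1, by omega⟩
    simp [coeff_eGen_univ] at this
  · ext1 i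
    simp only [Matrix.mulVec, dotProduct, Matrix.of_apply]
    rw [sum_jacobiTrudi_row n N β i _ hd, hGen_mul_eGen_compl, Finset.compl_univ,
      Finset.prod_empty, PowerSeries.coeff_one, if_neg]
    · rfl
    · have := h i i.2
      omega

lemma partLen_le {μ : ℕ → ℕ} {N : ℕ} (h : μ N = 0) : partLen μ ≤ N := Nat.sInf_le h

lemma IsPartition.eq_zero {μ : ℕ → ℕ} (hμ : IsPartition μ) {i : ℕ} (hi : partLen μ ≤ i) :
    μ i = 0 := by
  obtain ⟨N, hN⟩ := hμ.2
  have : μ (partLen μ) = 0 := Nat.sInf_mem (s := {N | μ N = 0}) ⟨N, hN N le_rfl⟩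
  exact Nat.le_zero.mp (this ▸ hμ.1 hi)

lemma IsPartition.jacobiTrudi_eq_schur {μ : ℕ → ℕ} (hμ : IsPartition μ) (n : ℕ) {N : ℕ}
    (hN : μ N = 0) : jacobiTrudi n N μ = schur n μ :=
  jacobiTrudi_of_le n μ (partLen_le hN) fun _ => hμ.eq_zero

lemma schur_eq_zero_of_lt {μ : ℕ → ℕ} (n : ℕ) (hn : n < partLen μ) : schur n μ = 0 :=
  jacobiTrudi_eq_zero_of_lt n _ μ hn fun _ hi => Nat.pos_of_ne_zero fun h =>
    (partLen_le h).not_gt hi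

namespace SchurPositive

variable {n : ℕ} {f g : MvPolynomial (Fin n) ℚ}

lemma zero : SchurPositive n 0 := ⟨∅, 0, by simp, by simp, by simp⟩

lemma add (hf : SchurPositive n f) (hg : SchurPositive n g) : SchurPositive n (f + g) := by
  classical
  obtain ⟨S, c, hS, hc, rfl⟩ := hf
  obtain ⟨T, d, hT, hd, rfl⟩ := hg
  refine ⟨S ∪ T, fun μ => (if μ ∈ S then c μ else 0) + if μ ∈ T then d μ else 0, ?_, ?_, ?_⟩
  · intro μ hμ
    exact (Finset.mem_union.mp hμ).elim (hS μ) (hT μ)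
  · intro μ _
    refine add_nonneg ?_ ?_
    · split_ifs with h
      exacts [hc μ h, le_rfl]
    · split_ifs with h
      exacts [hd μ h, le_rfl]
  · simp only [add_smul, Finset.sum_add_distrib, ite_smul, zero_smul]
    simp only [Finset.sum_ite_mem, Finset.union_inter_cancel_left,
      Finset.union_inter_cancel_right]

lemma smul (hf : SchurPositive n f) {a : ℚ} (ha : 0 ≤ a) : SchurPositive n (a • f) := by
  obtain ⟨S, c, hS, hc, rfl⟩ := hf
  refine ⟨S, fun μ => a * c μ, hS, fun μ hμ => mul_nonneg ha (hc μ hμ), ?_⟩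
  simp only [Finset.smul_sum, mul_smul]

lemma C_mul (hf : SchurPositive n f) {a : ℚ} (ha : 0 ≤ a) : SchurPositive n (C a * f) := by
  rw [← smul_eq_C_mul]
  exact hf.smul ha

lemma sum {ι : Type*} (s : Finset ι) {F : ι → MvPolynomial (Fin n) ℚ}
    (hF : ∀ i ∈ s, SchurPositive n (F i)) : SchurPositive n (∑ i ∈ s, F i) :=
  Finset.sum_induction F _ (fun _ _ => add) zero hF

lemma of_isPartition {μ : ℕ → ℕ} (hμ : IsPartition μ) : SchurPositive n (schur n μ) :=
  ⟨{μ}, 1, by simpa using hμ, by simp, by simp⟩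

/-- Sequences that are weakly decreasing up to adjacent increases by one index either Schur
polynomials or zero. -/
lemma of_jacobiTrudi {β : ℕ → ℕ} (h : ∀ i, i + 1 < n → β (i + 1) ≤ β i + 1) :
    SchurPositive n (jacobiTrudi n n β) := by
  by_cases h' : ∀ i, i + 1 < n → β (i + 1) ≤ β i
  · have hp : IsPartition fun i => if i < n then β i else 0 := by
      refine ⟨antitone_nat_of_succ_le fun i => ?_, n, fun i hi => if_neg hi.not_gt⟩
      split_ifs with h1 h2
      · exact h' i h1
      · omega
      · exact Nat.zero_le _
      · exact le_rfl
    rw [jacobiTrudi_congr n n (γ := fun i => if i < n then β i else 0)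
      fun i hi => (if_pos hi).symm, hp.jacobiTrudi_eq_schur n (if_neg (lt_irrefl n))]
    exact of_isPartition hp
  · push Not at h'
    obtain ⟨i, hi, hlt⟩ := h'
    rw [jacobiTrudi_eq_zero n n β hi (le_antisymm (h i hi) hlt)]
    exact zero

lemma esymm_mul (hf : SchurPositive n f) (m : ℕ) :
    SchurPositive n (esymm (Fin n) ℚ m * f) := by
  obtain ⟨S, c, hS, hc, rfl⟩ := hf
  rw [Finset.mul_sum]
  refine sum _ fun μ hμ => ?_
  rw [mul_smul_comm]
  refine smul ?_ (hc μ hμ)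
  rcases lt_or_ge n (partLen μ) with hn | hn
  · rw [schur_eq_zero_of_lt n hn, mul_zero]
    exact zero
  · rw [← (hS μ hμ).jacobiTrudi_eq_schur n ((hS μ hμ).eq_zero hn), esymm_mul_jacobiTrudi]
    refine sum _ fun T _ => of_jacobiTrudi fun i _ => ?_
    have := (hS μ hμ).1 i.le_succ
    simp only [Pi.add_apply, ind, Nat.succ_eq_add_one] at this ⊢
    split_ifs <;> omega

end SchurPositive

lemma SchurPositive.natCast_mul {n : ℕ} {f : MvPolynomial (Fin n) ℚ} (hf : SchurPositive n f)
    (k : ℕ) : SchurPositive n (k * f) := by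
  rw [← map_natCast (C : ℚ →+* MvPolynomial (Fin n) ℚ)]
  exact hf.C_mul k.cast_nonneg

lemma SchurPositive.of_two_mul {n : ℕ} {f : MvPolynomial (Fin n) ℚ}
    (hf : SchurPositive n (2 * f)) : SchurPositive n f := by
  have h := hf.smul (a := 1 / 2) (by norm_num)
  rwa [two_mul, ← two_smul ℚ f, smul_smul, one_div, inv_mul_cancel₀ two_ne_zero, one_smul] at h

lemma eq_range_of_lower {n m r : ℕ} {T : Finset ℕ} (hT : T ∈ Finset.powersetCard m (Finset.range n))
    (hr : r ∈ T → r = n) (h : ∀ i, i + 1 < n → i + 1 ≠ r → i + 1 ∈ T → i ∈ T) :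
    T = Finset.range m := by
  rw [Finset.mem_powersetCard] at hT
  have hlt {i : ℕ} (hi : i ∈ T) : i < n := Finset.mem_range.mp (hT.1 hi)
  have hge : ∀ j, r ≤ j → j ∉ T := by
    intro j hj
    induction j, hj using Nat.le_induction with
    | base => exact fun h' => (hlt h').ne (hr h')
    | succ j hj ih => exact fun h' => ih (h j (hlt h') (by omega) h')
  have hlow : ∀ j ∈ T, ∀ i ≤ j, i ∈ T := by
    intro j
    induction j with
    | zero => exact fun hj i hi => Nat.le_zero.mp hi ▸ hj
    | succ j ih =>
      intro hj i hi
      rcases hi.eq_or_lt with rfl | hi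
      · exact hj
      · exact ih (h j (hlt hj) (fun hjr => hge _ hjr.ge hj) hj) i (by omega)
  refine Finset.eq_of_subset_of_card_le (fun j hj => ?_) (by rw [Finset.card_range, hT.2])
  have : Finset.range (j + 1) ⊆ T := fun i hi => hlow j hj i (by simpa [Nat.lt_succ_iff] using hi)
  have := Finset.card_le_card this
  rw [Finset.card_range, hT.2] at this
  exact Finset.mem_range.mpr this

lemma esymm_eq_jacobiTrudi {n r : ℕ} (hr : r ≤ n) :
    esymm (Fin n) ℚ r = jacobiTrudi n n (ind (Finset.range r)) := by
  rw [← mul_one (esymm _ _ _), ← jacobiTrudi_zero n n, esymm_mul_jacobiTrudi,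
    Finset.sum_eq_single (Finset.range r), zero_add]
  · intro T hT hne
    by_contra h0
    refine hne (eq_range_of_lower hT (r := n) (fun _ => rfl) fun i hi _ hmem => ?_)
    by_contra hi'
    exact h0 (jacobiTrudi_eq_zero n n _ hi (by simp [ind, hmem, hi']))
  · intro h
    exact absurd (by simpa [Finset.mem_powersetCard] using hr) h

lemma esymm_eq_zero_of_lt {n r : ℕ} (hr : n < r) : esymm (Fin n) ℚ r = 0 := by
  rw [esymm, Finset.powersetCard_eq_empty.mpr (by simpa using hr), Finset.sum_empty]

lemma sum_powersetCard_eq_single {n m r : ℕ} (hr : r ≤ n) (hm : m ≤ r) :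
    ∑ T ∈ Finset.powersetCard m ((Finset.range n).erase r),
      jacobiTrudi n n (ind (Finset.range r) + ind T) =
      jacobiTrudi n n (ind (Finset.range r) + ind (Finset.range m)) := by
  refine Finset.sum_eq_single _ (fun T hT hne => ?_) fun h => ?_
  · by_contra h0
    have hrT : r ∉ T := fun h =>
      Finset.notMem_erase r _ ((Finset.mem_powersetCard.mp hT).1 h)
    have hT' := Finset.powersetCard_mono (Finset.erase_subset _ _) hT
    refine hne (eq_range_of_lower hT' (r := r) (fun h => absurd h hrT) fun i hi hir hmem => ?_)
    by_contra hi'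
    refine h0 (jacobiTrudi_eq_zero n n _ hi ?_)
    simp only [Pi.add_apply, ind, hmem, hi', Finset.mem_range, if_true, if_false]
    split_ifs <;> omega
  · refine absurd (Finset.mem_powersetCard.mpr ⟨fun i hi => ?_, Finset.card_range m⟩) h
    rw [Finset.mem_range] at hi
    rw [Finset.mem_erase, Finset.mem_range]
    omega

lemma sum_powersetCard_erase {n m r : ℕ} (hm : m ≤ r) :
    ∑ T ∈ Finset.powersetCard m ((Finset.range n).erase r),
      jacobiTrudi n n (ind (Finset.range (r + 1)) + ind T) =
      ∑ T ∈ Finset.powersetCard m (Finset.range n),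
        jacobiTrudi n n (ind (Finset.range (r + 1)) + ind T) := by
  refine Finset.sum_subset (Finset.powersetCard_mono (Finset.erase_subset _ _)) fun T hT hT' => ?_
  rw [Finset.mem_powersetCard] at hT
  have hrT : r ∈ T := by
    by_contra h
    exact hT' (Finset.mem_powersetCard.mpr ⟨Finset.subset_erase.mpr ⟨hT.1, h⟩, hT.2⟩)
  have hrn : r < n := Finset.mem_range.mp (hT.1 hrT)
  obtain ⟨i, hir, hi, hi'⟩ : ∃ i < r, i + 1 ∈ T ∧ i ∉ T := by
    by_contra! h
    have hsub : Finset.range (r + 1) ⊆ T := fun j hj =>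
      Nat.decreasingInduction (motive := fun j _ => j ∈ T) (fun i hi ih => h i hi ih) hrT
        (Nat.lt_succ_iff.mp (Finset.mem_range.mp hj))
    have := Finset.card_le_card hsub
    rw [Finset.card_range, hT.2] at this
    omega
  refine jacobiTrudi_eq_zero n n _ (i := i) (by omega) ?_
  simp only [Pi.add_apply, ind, hi, hi', Finset.mem_range, if_true, if_false]
  split_ifs <;> omega

/-- The dual Jacobi–Trudi identity for two columns. -/
lemma esymm_mul_sub_esymm_mul {n m r : ℕ} (hm : m < r) (hr : r ≤ n) :
    esymm (Fin n) ℚ (m + 1) * esymm (Fin n) ℚ r - esymm (Fin n) ℚ m * esymm (Fin n) ℚ (r + 1) =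
      jacobiTrudi n n (ind (Finset.range r) + ind (Finset.range (m + 1))) := by
  rw [← sum_powersetCard_eq_single hr hm, esymm_eq_jacobiTrudi hr, esymm_mul_jacobiTrudi]
  rcases hr.eq_or_lt with rfl | hr
  · rw [esymm_eq_zero_of_lt r.lt_succ_self, mul_zero, sub_zero,
      Finset.erase_eq_of_notMem Finset.notMem_range_self]
  · rw [esymm_eq_jacobiTrudi (Nat.succ_le_of_lt hr), esymm_mul_jacobiTrudi,
      ← sum_powersetCard_erase hm.le, sub_eq_iff_eq_add]
    have hn : Finset.range n = insert r ((Finset.range n).erase r) :=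
      (Finset.insert_erase (Finset.mem_range.mpr hr)).symm
    have hnot {k : ℕ} {T : Finset ℕ}
        (hT : T ∈ Finset.powersetCard k ((Finset.range n).erase r)) : r ∉ T := fun h =>
      Finset.notMem_erase r _ ((Finset.mem_powersetCard.mp hT).1 h)
    nth_rw 1 [hn]
    rw [Finset.powersetCard_succ_insert (Finset.notMem_erase _ _), Finset.sum_union,
      Finset.sum_image]
    · congr 1
      refine Finset.sum_congr rfl fun T hT => ?_
      congr 1
      ext i
      have := hnot hT
      by_cases hi : i = r
      · subst hi
        simp [ind, this]
      · have : i < r + 1 ↔ i < r := by omega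
        simp [ind, hi, this]
    · intro S hS T hT hST
      rw [← Finset.erase_insert (hnot hS), ← Finset.erase_insert (hnot hT)]
      exact congrArg (·.erase r) hST
    · rw [Finset.disjoint_left]
      intro T hT hT'
      obtain ⟨S, _, rfl⟩ := Finset.mem_image.mp hT'
      exact hnot hT (Finset.mem_insert_self _ _)

lemma schurPositive_one (n : ℕ) : SchurPositive n 1 := by
  rw [← jacobiTrudi_zero n n]
  exact .of_jacobiTrudi fun _ _ => by simp

lemma schurPositive_esymm (n m : ℕ) : SchurPositive n (esymm (Fin n) ℚ m) := by
  simpa using (schurPositive_one n).esymm_mul m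

/-- Positivity of the dual Jacobi–Trudi determinant with columns `(r, r, 1)`. -/
lemma schurPositive_esymm_det {n r : ℕ} (hr : r + 1 < n) :
    SchurPositive n (esymm (Fin n) ℚ 1 * (esymm (Fin n) ℚ (r + 1) ^ 2 -
        esymm (Fin n) ℚ r * esymm (Fin n) ℚ (r + 2)) -
      (esymm (Fin n) ℚ (r + 1) * esymm (Fin n) ℚ (r + 2) -
        esymm (Fin n) ℚ r * esymm (Fin n) ℚ (r + 3))) := by
  rw [sq, esymm_mul_sub_esymm_mul (by omega) hr.le, esymm_mul_sub_esymm_mul (by omega) hr,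
    esymm_mul_jacobiTrudi]
  have hmem : {r + 1} ∈ Finset.powersetCard 1 (Finset.range n) := by
    simpa [Finset.mem_powersetCard] using hr
  have heq : ind (Finset.range (r + 1)) + ind (Finset.range (r + 1)) + ind {r + 1} =
      ind (Finset.range (r + 2)) + ind (Finset.range (r + 1)) := by
    ext i
    simp only [Pi.add_apply, ind, Finset.mem_range, Finset.mem_singleton]
    split_ifs <;> omega
  rw [← Finset.add_sum_erase _ _ hmem, heq, add_sub_cancel_left]
  refine .sum _ fun T _ => .of_jacobiTrudi fun i _ => ?_
  simp only [Pi.add_apply, ind, Finset.mem_range]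
  split_ifs <;> omega

/-- The derivation `∑ᵢ ∂/∂xᵢ`. -/
def shiftDerivation (n : ℕ) : Derivation ℚ (MvPolynomial (Fin n) ℚ) (MvPolynomial (Fin n) ℚ) :=
  mkDerivation ℚ fun _ => 1

lemma derived_add (n i : ℕ) (p q : MvPolynomial (Fin n) ℚ) :
    derived n i (p + q) = derived n i p + derived n i q := by
  simp [derived]

lemma derived_C_zero (n : ℕ) (a : ℚ) : derived n 0 (C a) = C a := by
  simp [derived, ← algebraMap_eq, Polynomial.algebraMap_apply]

lemma derived_C_succ (n i : ℕ) (a : ℚ) : derived n (i + 1) (C a) = 0 := by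
  simp [derived, ← algebraMap_eq, Polynomial.algebraMap_apply]

lemma derived_zero_mul_X (n : ℕ) (p : MvPolynomial (Fin n) ℚ) (j : Fin n) :
    derived n 0 (p * X j) = derived n 0 p * X j := by
  simp [derived, mul_add]

lemma derived_succ_mul_X (n i : ℕ) (p : MvPolynomial (Fin n) ℚ) (j : Fin n) :
    derived n (i + 1) (p * X j) = derived n (i + 1) p * X j + derived n i p := by
  simp [derived, mul_add]

lemma derived_zero (n : ℕ) (p : MvPolynomial (Fin n) ℚ) : derived n 0 p = p := by
  induction p using MvPolynomial.induction_on with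
  | C a => exact derived_C_zero n a
  | add p q hp hq => rw [derived_add, hp, hq]
  | mul_X p j hp => rw [derived_zero_mul_X, hp]

lemma shiftDerivation_mul_X (n : ℕ) (p : MvPolynomial (Fin n) ℚ) (j : Fin n) :
    shiftDerivation n (p * X j) = shiftDerivation n p * X j + p := by
  rw [Derivation.leibniz, shiftDerivation, mkDerivation_X, smul_eq_mul, smul_eq_mul]
  ring

lemma derived_one (n : ℕ) (p : MvPolynomial (Fin n) ℚ) :
    derived n 1 p = shiftDerivation n p := by
  induction p using MvPolynomial.induction_on with
  | C a => rw [derived_C_succ, shiftDerivation, derivation_C]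
  | add p q hp hq => rw [derived_add, hp, hq, map_add]
  | mul_X p j hp => rw [derived_succ_mul_X, hp, derived_zero, shiftDerivation_mul_X]

lemma two_mul_derived_two (n : ℕ) (p : MvPolynomial (Fin n) ℚ) :
    2 * derived n 2 p = shiftDerivation n (shiftDerivation n p) := by
  induction p using MvPolynomial.induction_on with
  | C a => rw [derived_C_succ, mul_zero, shiftDerivation, derivation_C, map_zero]
  | add p q hp hq => rw [derived_add, mul_add, hp, hq, map_add, map_add]
  | mul_X p j hp =>
    rw [derived_succ_mul_X, mul_add, ← mul_assoc, hp, derived_one, shiftDerivation_mul_X, map_add,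
      shiftDerivation_mul_X]
    ring

lemma shiftDerivation_prod (n : ℕ) (S : Finset (Fin n)) :
    shiftDerivation n (∏ i ∈ S, X i) = ∑ i ∈ S, ∏ j ∈ S.erase i, X j := by
  induction S using Finset.induction_on with
  | empty => simp
  | insert a S ha ih =>
    rw [Finset.prod_insert ha, mul_comm, shiftDerivation_mul_X, ih, Finset.sum_insert ha,
      Finset.erase_insert ha, add_comm, Finset.sum_mul]
    congr 1
    refine Finset.sum_congr rfl fun i hi => ?_
    have hai : a ≠ i := fun h => ha (h ▸ hi)
    rw [Finset.erase_insert_of_ne hai, Finset.prod_insert (fun h => ha (Finset.mem_of_mem_erase h)),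
      mul_comm]

lemma shiftDerivation_esymm (n m : ℕ) :
    shiftDerivation n (esymm (Fin n) ℚ (m + 1)) = ((n : MvPolynomial (Fin n) ℚ) - m) *
      esymm (Fin n) ℚ m := by
  have h : ∀ T ∈ Finset.powersetCard m (Finset.univ : Finset (Fin n)),
      ∑ _i ∈ Tᶜ, ∏ j ∈ T, (X j : MvPolynomial (Fin n) ℚ) =
        ((n : MvPolynomial (Fin n) ℚ) - (m : MvPolynomial (Fin n) ℚ)) * ∏ j ∈ T, X j := by
    intro T hT
    have hc := (Finset.mem_powersetCard.mp hT).2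
    have : m ≤ n := by simpa [hc] using Finset.card_le_univ T
    rw [Finset.sum_const, Finset.card_compl, hc, Fintype.card_fin, nsmul_eq_mul,
      Nat.cast_sub this]
  unfold esymm
  rw [map_sum, Finset.mul_sum, ← Finset.sum_congr rfl h]
  simp only [shiftDerivation_prod]
  rw [Finset.sum_sigma', Finset.sum_sigma']
  refine Finset.sum_bij' (fun x _ => ⟨x.1.erase x.2, x.2⟩) (fun y _ => ⟨insert y.2 y.1, y.2⟩)
    ?_ ?_ ?_ ?_ ?_
  · rintro ⟨S, i⟩ hx
    simp only [Finset.mem_sigma, Finset.mem_powersetCard, Finset.subset_univ, true_and,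
      Finset.mem_compl] at hx ⊢
    simp [Finset.card_erase_of_mem hx.2, hx.1]
  · rintro ⟨T, i⟩ hy
    simp only [Finset.mem_sigma, Finset.mem_powersetCard, Finset.subset_univ, true_and,
      Finset.mem_compl] at hy ⊢
    simp [Finset.card_insert_of_notMem hy.2, hy.1]
  · rintro ⟨S, i⟩ hx
    simp only [Finset.mem_sigma] at hx
    simp [Finset.insert_erase hx.2]
  · rintro ⟨T, i⟩ hy
    simp only [Finset.mem_sigma, Finset.mem_compl] at hy
    simp [Finset.erase_insert hy.2]
  · rintro ⟨S, i⟩ _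
    rfl

lemma sum_antidiagonal_esymm_mul_hsymm (n m : ℕ) :
    ∑ x ∈ Finset.HasAntidiagonal.antidiagonal m,
      (-1) ^ x.1 * esymm (Fin n) ℚ x.1 * hsymm (Fin n) ℚ x.2 =
      if m = 0 then 1 else 0 := by
  have h := hGen_mul_eGen_compl n Finset.univ
  rw [Finset.compl_univ, Finset.prod_empty, mul_comm] at h
  rw [← PowerSeries.coeff_one, ← h, PowerSeries.coeff_mul]
  refine Finset.sum_congr rfl fun x _ => ?_
  rw [Polynomial.coeff_coe, coeff_eGen_univ, coeff_hGen]

lemma shiftDerivation_hsymm (n m : ℕ) :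
    shiftDerivation n (hsymm (Fin n) ℚ (m + 1)) = ((n : MvPolynomial (Fin n) ℚ) + m) *
      hsymm (Fin n) ℚ m := by
  induction m using Nat.strong_induction_on with
  | _ m ih =>
  have hz : (m : MvPolynomial (Fin n) ℚ) * ∑ x ∈ Finset.HasAntidiagonal.antidiagonal m,
      (-1) ^ x.1 * esymm (Fin n) ℚ x.1 * hsymm (Fin n) ℚ x.2 = 0 := by
    rw [sum_antidiagonal_esymm_mul_hsymm]
    rcases eq_or_ne m 0 with rfl | h <;> simp [*]
  have hd := congrArg (shiftDerivation n) (sum_antidiagonal_esymm_mul_hsymm n (m + 1))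
  have hpow (k : ℕ) : shiftDerivation n ((-1) ^ k) = 0 := by
    rw [← map_one C, ← map_neg, ← map_pow, shiftDerivation, derivation_C]
  rw [if_neg m.succ_ne_zero, map_zero, map_sum] at hd
  simp only [Derivation.leibniz, hpow, smul_eq_mul, mul_zero, add_zero] at hd
  rw [Finset.sum_add_distrib, Finset.Nat.sum_antidiagonal_succ',
    Finset.Nat.sum_antidiagonal_succ (f := fun x => hsymm (Fin n) ℚ x.2 * _)] at hd
  simp only [esymm_zero, hsymm_zero, Derivation.map_one_eq_zero, mul_zero, zero_add,
    shiftDerivation_esymm] at hd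
  rw [Finset.mul_sum] at hz
  have key : ∑ x ∈ Finset.HasAntidiagonal.antidiagonal m, (-1) ^ x.1 * esymm (Fin n) ℚ x.1 *
      (shiftDerivation n (hsymm (Fin n) ℚ (x.2 + 1)) -
        ((n : MvPolynomial (Fin n) ℚ) + x.2) * hsymm (Fin n) ℚ x.2) = 0 := by
    refine Eq.trans ?_ ((congrArg₂ HSub.hSub hd hz).trans (sub_zero 0))
    rw [← Finset.sum_add_distrib, ← Finset.sum_sub_distrib]
    refine Finset.sum_congr rfl fun x hx => ?_
    rw [← Finset.HasAntidiagonal.mem_antidiagonal.mp hx]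
    push_cast
    ring
  rw [Finset.sum_eq_single (0, m)] at key
  · simpa [sub_eq_zero] using key
  · intro x hx hne
    rw [Finset.HasAntidiagonal.mem_antidiagonal] at hx
    have : x.2 < m := by
      rcases Nat.eq_zero_or_pos x.1 with h | h
      · exact absurd (Prod.ext h (by simpa [h] using hx)) hne
      · omega
    rw [ih x.2 this, sub_self, mul_zero]
  · intro h
    exact absurd (by simp) h

lemma hook_isPartition {k ℓ : ℕ} (hk : 1 ≤ k) :
    IsPartition fun i => if i = 0 then k else if i < ℓ then 1 else 0 := by
  refine ⟨antitone_nat_of_succ_le fun i => ?_, ℓ + 1, fun i hi => ?_⟩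
  · grind
  · dsimp only
    split_ifs <;> omega

lemma jacobiTrudi_two (n : ℕ) (μ : ℕ → ℕ) :
    jacobiTrudi n 2 μ = hInt n (μ 0) * hInt n (μ 1) - hInt n (μ 0 + 1) * hInt n (μ 1 - 1) := by
  simp [jacobiTrudi, Matrix.det_fin_two]

lemma schur_two_row (n : ℕ) {μ : ℕ → ℕ} (hμ : IsPartition μ) (h2 : μ 2 = 0) {a b : ℕ}
    (h0 : μ 0 = a) (h1 : μ 1 = b + 1) :
    schur n μ = hsymm (Fin n) ℚ a * hsymm (Fin n) ℚ (b + 1) -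
      hsymm (Fin n) ℚ (a + 1) * hsymm (Fin n) ℚ b := by
  rw [← hμ.jacobiTrudi_eq_schur n h2, jacobiTrudi_two, h0, h1]
  simp only [← hInt_natCast]
  push_cast
  rw [add_sub_cancel_right]

lemma schurPositive_hsymm (n a : ℕ) : SchurPositive n (hsymm (Fin n) ℚ a) := by
  have hμ : IsPartition fun i => if i = 0 then a else 0 :=
    ⟨antitone_nat_of_succ_le fun i => by simp, 1, fun i hi => if_neg (by omega)⟩
  have h : schur n (fun i => if i = 0 then a else 0) = hsymm (Fin n) ℚ a := by
    rw [← hμ.jacobiTrudi_eq_schur n (N := 1) (if_neg one_ne_zero), ← hInt_natCast]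
    simp [jacobiTrudi]
  exact h ▸ .of_isPartition hμ

lemma schurPositive_two_row (n : ℕ) {a b : ℕ} (hab : b < a) :
    SchurPositive n (hsymm (Fin n) ℚ a * hsymm (Fin n) ℚ (b + 1) -
      hsymm (Fin n) ℚ (a + 1) * hsymm (Fin n) ℚ b) := by
  have hμ : IsPartition fun i => if i = 0 then a else if i = 1 then b + 1 else 0 := by
    refine ⟨antitone_nat_of_succ_le fun i => ?_, 2, fun i hi => ?_⟩
    · grind
    · dsimp only
      split_ifs <;> omega
  rw [← schur_two_row n hμ (a := a) (b := b) rfl rfl rfl]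
  exact .of_isPartition hμ

lemma schurPositive_three_row (n : ℕ) {a b : ℕ} (hab : b < a) :
    SchurPositive n (hsymm (Fin n) ℚ 1 * (hsymm (Fin n) ℚ a * hsymm (Fin n) ℚ (b + 1) -
        hsymm (Fin n) ℚ (a + 1) * hsymm (Fin n) ℚ b) -
      (hsymm (Fin n) ℚ a * hsymm (Fin n) ℚ (b + 2) -
        hsymm (Fin n) ℚ (a + 2) * hsymm (Fin n) ℚ b)) := by
  set μ : ℕ → ℕ := fun i => if i = 0 then a else if i = 1 then b + 1 else if i = 2 then 1 else 0
    with hμ_def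
  have hμ : IsPartition μ := by
    refine ⟨antitone_nat_of_succ_le fun i => ?_, 3, fun i hi => ?_⟩
    · grind
    · simp only [hμ_def]
      split_ifs <;> omega
  convert SchurPositive.of_isPartition (n := n) hμ using 1
  have h0 : μ 0 = a := rfl
  have h1 : μ 1 = b + 1 := rfl
  have h2 : μ 2 = 1 := rfl
  rw [← hμ.jacobiTrudi_eq_schur n (N := 3) rfl, jacobiTrudi, Matrix.det_fin_three]
  simp only [Matrix.of_apply, Fin.val_zero, Fin.val_one, Fin.val_two, h0, h1, h2]
  have e1 : ((b + 1 : ℕ) : ℤ) + (0 : ℕ) - (1 : ℕ) = (b : ℕ) := by push_cast; ring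
  have e2 : ((b + 1 : ℕ) : ℤ) + (1 : ℕ) - (1 : ℕ) = (b + 1 : ℕ) := by push_cast; ring
  have e3 : ((b + 1 : ℕ) : ℤ) + (2 : ℕ) - (1 : ℕ) = (b + 2 : ℕ) := by push_cast; ring
  have e4 : ((1 : ℕ) : ℤ) + (0 : ℕ) - (2 : ℕ) = -1 := by norm_num
  have e5 : ((1 : ℕ) : ℤ) + (1 : ℕ) - (2 : ℕ) = (0 : ℕ) := by norm_num
  have e6 : ((1 : ℕ) : ℤ) + (2 : ℕ) - (2 : ℕ) = (1 : ℕ) := by norm_num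
  have e7 (j : ℕ) : (a : ℤ) + (j : ℕ) - (0 : ℕ) = (a + j : ℕ) := by push_cast; ring
  rw [e1, e2, e3, e4, e5, e6, e7, e7, e7, hInt_of_neg n (by norm_num : (-1 : ℤ) < 0)]
  simp only [hInt_natCast, hsymm_zero, add_zero]
  ring

lemma SchurPositive.hsymm_one_mul {n : ℕ} {f : MvPolynomial (Fin n) ℚ} (hf : SchurPositive n f) :
    SchurPositive n (hsymm (Fin n) ℚ 1 * f) := by
  rw [hsymm_one, ← esymm_one]
  exact hf.esymm_mul 1

lemma schurPositive_hsymm_mul_hsymm (n : ℕ) {a b : ℕ} (hab : b ≤ a) :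
    SchurPositive n (hsymm (Fin n) ℚ a * hsymm (Fin n) ℚ b) := by
  induction b generalizing a with
  | zero => simpa using schurPositive_hsymm n a
  | succ b ih =>
    have := (schurPositive_two_row n hab).add (ih (a := a + 1) (by omega))
    rwa [sub_add_cancel] at this

/-- Positivity of the product of `h_a` and the Schur polynomial of the hook `(b, 1)`. -/
lemma schurPositive_hsymm_mul_hook (n : ℕ) {a b : ℕ} (hab : b ≤ a) :
    SchurPositive n (hsymm (Fin n) ℚ a *
      (hsymm (Fin n) ℚ 1 * hsymm (Fin n) ℚ b - hsymm (Fin n) ℚ (b + 1))) := by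
  induction b generalizing a with
  | zero => simpa using SchurPositive.zero
  | succ b ih =>
    have := ((schurPositive_three_row n hab).add
      (schurPositive_two_row n (a := a + 1) (b := b) (by omega))).add (ih (a := a + 1) (by omega))
    convert this using 1
    ring

/-- Positivity of the product of the Schur polynomials of the hooks `(a, 1)` and `(b, 1)`. -/
lemma schurPositive_hook_mul_hook (n : ℕ) {a b : ℕ} (hab : b ≤ a) :
    SchurPositive n ((hsymm (Fin n) ℚ 1 * hsymm (Fin n) ℚ a - hsymm (Fin n) ℚ (a + 1)) *
      (hsymm (Fin n) ℚ 1 * hsymm (Fin n) ℚ b - hsymm (Fin n) ℚ (b + 1))) := by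
  induction b generalizing a with
  | zero => simpa using SchurPositive.zero
  | succ b ih =>
    have := ((schurPositive_three_row n hab).hsymm_one_mul.add
      (schurPositive_two_row n (a := a + 1) (b := b + 1) (by omega))).add
      (ih (a := a + 1) (by omega))
    convert this using 1
    ring

/-- The case of hooks with two columns. -/
lemma schurPositive_two_column_hook (n q : ℕ) (hn : q + 2 ≤ n) {s : MvPolynomial (Fin n) ℚ}
    (hs : s = esymm (Fin n) ℚ 1 * esymm (Fin n) ℚ (q + 2) - esymm (Fin n) ℚ (q + 3)) :
    SchurPositive n (derived n 1 s ^ 2 - s * derived n 2 s) := by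
  obtain ⟨M, hM⟩ := Nat.exists_eq_add_of_le hn
  have hnM : (n : MvPolynomial (Fin n) ℚ) = q + 2 + M := by exact_mod_cast congrArg Nat.cast hM
  have h1 : shiftDerivation n (esymm (Fin n) ℚ 1) = q + 2 + M := by
    simpa [hnM] using shiftDerivation_esymm n 0
  have hD : derived n 1 s =
      ((M + 1 : ℕ) : MvPolynomial (Fin n) ℚ) * (esymm (Fin n) ℚ 1 * esymm (Fin n) ℚ (q + 1)) +
        ((q + 2 : ℕ) : MvPolynomial (Fin n) ℚ) * esymm (Fin n) ℚ (q + 2) := by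
    rw [derived_one, hs]
    simp only [map_sub, Derivation.leibniz, smul_eq_mul, shiftDerivation_esymm, h1, hnM]
    push_cast
    ring
  have hDD : 2 * derived n 2 s = ((M : MvPolynomial (Fin n) ℚ) + 1) *
      ((M + 2) * (esymm (Fin n) ℚ 1 * esymm (Fin n) ℚ q) +
        (2 * q + 4 + M) * esymm (Fin n) ℚ (q + 1)) := by
    rw [two_mul_derived_two, ← derived_one n s, hD]
    simp only [map_add, Derivation.leibniz, Derivation.map_natCast, smul_eq_mul,
      shiftDerivation_esymm, h1, hnM]
    push_cast
    ring
  apply SchurPositive.of_two_mul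
  rw [mul_sub, mul_left_comm, hDD, hD, hs]
  have hdet : SchurPositive n (esymm (Fin n) ℚ 1 *
      (esymm (Fin n) ℚ 1 * (esymm (Fin n) ℚ (q + 1) ^ 2 -
        esymm (Fin n) ℚ q * esymm (Fin n) ℚ (q + 2)) -
      (esymm (Fin n) ℚ (q + 1) * esymm (Fin n) ℚ (q + 2) -
        esymm (Fin n) ℚ q * esymm (Fin n) ℚ (q + 3)))) :=
    (schurPositive_esymm_det (by omega)).esymm_mul 1
  have hee (i j : ℕ) : SchurPositive n (esymm (Fin n) ℚ i * esymm (Fin n) ℚ j) :=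
    (schurPositive_esymm n j).esymm_mul i
  have := ((((hdet.natCast_mul ((M + 1) * (M + 2))).add
    ((((hee (q + 1) (q + 1)).esymm_mul 1).esymm_mul 1).natCast_mul ((M + 1) * M))).add
    (((hee (q + 1) (q + 2)).esymm_mul 1).natCast_mul (2 * (M + 1) * (q + 3)))).add
    ((hee (q + 2) (q + 2)).natCast_mul (2 * (q + 2) ^ 2))).add
    ((hee (q + 1) (q + 3)).natCast_mul ((M + 1) * (2 * q + 4 + M)))
  convert this using 1
  push_cast
  ring

/-- The case of hooks with two rows. -/
lemma schurPositive_two_row_hook (n q : ℕ) (hn : 2 ≤ n) {s : MvPolynomial (Fin n) ℚ}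
    (hs : s = hsymm (Fin n) ℚ 1 * hsymm (Fin n) ℚ (q + 2) - hsymm (Fin n) ℚ (q + 3)) :
    SchurPositive n (derived n 1 s ^ 2 - s * derived n 2 s) := by
  obtain ⟨M, hM⟩ := Nat.exists_eq_add_of_le hn
  have hnM : (n : MvPolynomial (Fin n) ℚ) = 2 + M := by exact_mod_cast congrArg Nat.cast hM
  have h1 : shiftDerivation n (hsymm (Fin n) ℚ 1) = 2 + M := by
    simpa [hnM] using shiftDerivation_hsymm n 0
  have hD : derived n 1 s =
      ((M + q + 3 : ℕ) : MvPolynomial (Fin n) ℚ) * (hsymm (Fin n) ℚ 1 * hsymm (Fin n) ℚ (q + 1)) -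
        ((q + 2 : ℕ) : MvPolynomial (Fin n) ℚ) * hsymm (Fin n) ℚ (q + 2) := by
    rw [derived_one, hs]
    simp only [map_sub, Derivation.leibniz, smul_eq_mul, shiftDerivation_hsymm, h1, hnM]
    push_cast
    ring
  have hDD : 2 * derived n 2 s = ((M : MvPolynomial (Fin n) ℚ) + q + 3) *
      ((M + q + 2) * (hsymm (Fin n) ℚ 1 * hsymm (Fin n) ℚ q) +
        (M - q) * hsymm (Fin n) ℚ (q + 1)) := by
    rw [two_mul_derived_two, ← derived_one n s, hD]
    simp only [map_sub, Derivation.leibniz, Derivation.map_natCast, smul_eq_mul,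
      shiftDerivation_hsymm, h1, hnM]
    push_cast
    ring
  apply SchurPositive.of_two_mul
  rw [mul_sub, mul_left_comm, hDD, hD, hs]
  have := (((((schurPositive_three_row n q.lt_succ_self).hsymm_one_mul.natCast_mul
      ((M + q + 3) * (M + q + 2))).add
    ((schurPositive_hook_mul_hook n (le_refl (q + 1))).natCast_mul
      ((M + q + 3) * (M + q + 4)))).add
    ((schurPositive_hsymm_mul_hook n (q + 1).le_succ).natCast_mul
      (2 * (M + q + 3) * (M + 1)))).add
    ((schurPositive_two_row n (q + 1).lt_succ_self).natCast_mul
      ((M + 1) * M + (q + 2) * (q + 1)))).add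
    ((schurPositive_hsymm_mul_hsymm n (show q + 1 ≤ q + 3 by omega)).natCast_mul
      (2 * (M + 1) ^ 2))
  convert this using 1
  simp only [Nat.succ_eq_add_one]
  push_cast
  ring

/-- for a hook partition `λ = (k, 1^(ℓ-1))` with `k, ℓ ≥ 2` and `k = 2` or
`ℓ = 2`, and `n ≥ ℓ = ℓ(λ)` variables, `(s_λ^{(1)})^2 - s_λ * s_λ^{(2)}` is Schur
positive. -/
theorem small_hook_schur_positive (k ℓ n : ℕ) (hk : 2 ≤ k) (hℓ : 2 ≤ ℓ)
    (hcase : k = 2 ∨ ℓ = 2) (hn : ℓ ≤ n) :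
    SchurPositive n
      ((derived n 1 (schur n (fun i => if i = 0 then k else if i < ℓ then 1 else 0))) ^ 2 -
        schur n (fun i => if i = 0 then k else if i < ℓ then 1 else 0) *
          derived n 2 (schur n (fun i => if i = 0 then k else if i < ℓ then 1 else 0))) := by
  have hp := hook_isPartition (ℓ := ℓ) (show 1 ≤ k by omega)
  rcases hcase with rfl | rfl
  · obtain ⟨q, rfl⟩ := Nat.exists_eq_add_of_le' hℓ
    refine schurPositive_two_column_hook n q hn ?_
    have h := esymm_mul_sub_esymm_mul (m := 0) (show 0 < q + 2 by omega) hn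
    rw [esymm_zero, one_mul] at h
    rw [h, ← hp.jacobiTrudi_eq_schur n (N := n) (by rw [if_neg (by omega), if_neg (by omega)])]
    congr 1
    ext i
    simp only [Pi.add_apply, ind, Finset.mem_range]
    split_ifs <;> omega
  · obtain ⟨q, rfl⟩ := Nat.exists_eq_add_of_le' hk
    refine schurPositive_two_row_hook n q hn ?_
    rw [schur_two_row n hp (a := q + 2) (b := 0) rfl rfl rfl, hsymm_zero, mul_one, mul_comm]

end
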